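/- Let G be a finite simple graph that is C_3-free, C_5-free and C_6-free, let x be a vertex and Y ⊆ N(x) with |Y| ≥ 2. Then Y is extendable with respect to x (i.e., there exists a minimal redundant set R of G with red(R) = {x} and R ∩ N(x) = Y) if and only if: (a) each y ∈ Y has a private neighbor with respect to Y ∪ {x}; and (b) the set N²(x) \ N(Y) dominates N(x) \ Y. -/

import Mathlib

open Set SimpleGraph

variable {V : Type*}

/-- The closed neighborhood `N[v]` of a vertex. -/
def closedNbr (G : SimpleGraph V) (v : V) : Set V := insert v (G.neighborSet v)

/-- Private neighbors of `x` with respect to `I`. -/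
def privSet (G : SimpleGraph V) (x : V) (I : Set V) : Set V :=
  {y ∈ closedNbr G x | closedNbr G y ∩ I = {x}}

/-- A set is irredundant if every element has a private neighbor. -/
def Irred (G : SimpleGraph V) (I : Set V) : Prop := ∀ x ∈ I, (privSet G x I).Nonempty

/-- A maximal irredundant set. -/
def MaxIrred (G : SimpleGraph V) (I : Set V) : Prop :=
  Irred G I ∧ ∀ J : Set V, Irred G J → I ⊆ J → J = I

def Redundant (G : SimpleGraph V) (R : Set V) : Prop := ¬ Irred G R

def MinRedundant (G : SimpleGraph V) (R : Set V) : Prop :=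
  Redundant G R ∧ ∀ S : Set V, S ⊂ R → ¬ Redundant G S

/-- The set of redundant vertices of a set. -/
def redVerts (G : SimpleGraph V) (R : Set V) : Set V := {x ∈ R | privSet G x R = ∅}

def Dominating (G : SimpleGraph V) (D : Set V) : Prop := ∀ v : V, ∃ d ∈ D, v ∈ closedNbr G d

def MinDominating (G : SimpleGraph V) (D : Set V) : Prop :=
  Dominating G D ∧ ∀ S : Set V, S ⊂ D → ¬ Dominating G S

/-- Vertices at distance at most 2 from `x`. -/
def ball2 (G : SimpleGraph V) (x : V) : Set V :=
  {y | y = x ∨ G.Adj x y ∨ ∃ w, G.Adj x w ∧ G.Adj w y}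

/-- Vertices at distance exactly 2 from `x`. -/
def sphere2 (G : SimpleGraph V) (x : V) : Set V :=
  {y | y ≠ x ∧ ¬ G.Adj x y ∧ ∃ w, G.Adj x w ∧ G.Adj w y}

/-- `G` contains no induced cycle of length `k`. -/
def CFree (G : SimpleGraph V) (k : ℕ) : Prop :=
  IsEmpty (SimpleGraph.cycleGraph k ↪g G)

/-- `S` dominates `B` through open neighborhoods. -/
def DomOver (G : SimpleGraph V) (S B : Set V) : Prop := ∀ b ∈ B, ∃ s ∈ S, G.Adj s b

def MinDomOver (G : SimpleGraph V) (S B : Set V) : Prop :=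
  DomOver G S B ∧ ∀ S' : Set V, S' ⊂ S → ¬ DomOver G S' B

/-- `N(Y)`, the union of open neighborhoods of elements of `Y`. -/
def nbrUnion (G : SimpleGraph V) (Y : Set V) : Set V := ⋃ y ∈ Y, G.neighborSet y

/-- Private edges of `x` with respect to `I` in a hypergraph. -/
def hypPriv (H : Set (Set V)) (x : V) (I : Set V) : Set (Set V) := {E ∈ H | E ∩ I = {x}}

def HypIrred (H : Set (Set V)) (I : Set V) : Prop := ∀ x ∈ I, (hypPriv H x I).Nonempty

def HypMaxIrred (H : Set (Set V)) (I : Set V) : Prop :=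
  HypIrred H I ∧ ∀ J : Set V, HypIrred H J → I ⊆ J → J = I

/-- The trace of a hypergraph on a set `S`. -/
def htrace (H : Set (Set V)) (S : Set V) : Set (Set V) :=
  {F | ∃ E ∈ H, F = E ∩ S ∧ (E ∩ S).Nonempty}

/-- The closed-neighborhood hypergraph of a graph. -/
def nbrHyp (G : SimpleGraph V) : Set (Set V) := Set.range (closedNbr G)

/-- The first `i` vertices in the ordering `v` (zero-based: `v 0, …, v (i-1)`). -/
def firstVerts (v : ℕ → V) (i : ℕ) : Set V := {x | ∃ j < i, v j = x}

/-- The incidence co-bipartite graph of the closed-neighborhood hypergraph of `G`: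
`Sum.inl` is the vertex side `V`, `Sum.inr` is the copy `U`. -/
def cobip (G : SimpleGraph V) : SimpleGraph (V ⊕ V) :=
  SimpleGraph.fromRel (fun a b => match a, b with
    | Sum.inl _, Sum.inl _ => True
    | Sum.inr _, Sum.inr _ => True
    | Sum.inl a, Sum.inr b => a = b ∨ G.Adj a b
    | Sum.inr _, Sum.inl _ => False)

theorem CFree.not_triangle {G : SimpleGraph V} (h3 : CFree G 3) {a b c : V}
    (hab : G.Adj a b) (hbc : G.Adj b c) (hca : G.Adj c a) : False := by
  have hadj : ∀ i j : Fin 3, G.Adj (![a, b, c] i) (![a, b, c] j) ↔ (cycleGraph 3).Adj i j := by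
    intro i j
    rw [cycleGraph_three_eq_top, top_adj]
    fin_cases i <;> fin_cases j <;> simp [hab, hbc, hca, hab.symm, hbc.symm, hca.symm]
  refine h3.false ⟨⟨![a, b, c], fun i j hij => ?_⟩, fun {i j} => hadj i j⟩
  by_contra hne
  have := (hadj i j).2 (by rwa [cycleGraph_three_eq_top, top_adj])
  exact this.ne hij

/-- In a `(C₃, C₅)`-free graph there is no closed walk of length five. -/
theorem CFree.not_pentagon {G : SimpleGraph V} (h3 : CFree G 3) (h5 : CFree G 5) {a b c d e : V}
    (hab : G.Adj a b) (hbc : G.Adj b c) (hcd : G.Adj c d) (hde : G.Adj d e)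
    (hea : G.Adj e a) : False := by
  have hac : ¬ G.Adj a c := fun h => h3.not_triangle hab hbc h.symm
  have hbd : ¬ G.Adj b d := fun h => h3.not_triangle hbc hcd h.symm
  have hce : ¬ G.Adj c e := fun h => h3.not_triangle hcd hde h.symm
  have hda : ¬ G.Adj d a := fun h => h3.not_triangle hde hea h.symm
  have heb : ¬ G.Adj e b := fun h => h3.not_triangle hea hab h.symm
  have hadj : ∀ i j : Fin 5,
      G.Adj (![a, b, c, d, e] i) (![a, b, c, d, e] j) ↔ (cycleGraph 5).Adj i j := by
    intro i j
    rw [cycleGraph_adj]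
    fin_cases i <;> fin_cases j <;>
      simp [hab, hbc, hcd, hde, hea, hac, hbd, hce, hda, heb, G.adj_comm b a, G.adj_comm c b,
        G.adj_comm d c, G.adj_comm e d, G.adj_comm a e, G.adj_comm c a, G.adj_comm d b,
        G.adj_comm e c, G.adj_comm a d, G.adj_comm b e] <;> decide
  have htwin : ∀ i j : Fin 5,
      (∀ k, (cycleGraph 5).Adj i k ↔ (cycleGraph 5).Adj j k) → i = j := by
    simp only [cycleGraph_adj]
    decide
  refine h5.false ⟨⟨![a, b, c, d, e], fun i j hij => htwin i j fun k => ?_⟩, fun {i j} => hadj i j⟩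
  rw [← hadj, ← hadj, hij]

theorem mem_closedNbr {G : SimpleGraph V} {v w : V} :
    w ∈ closedNbr G v ↔ w = v ∨ G.Adj v w := Iff.rfl

theorem mem_privSet {G : SimpleGraph V} {x p : V} {I : Set V} :
    p ∈ privSet G x I ↔
      x ∈ I ∧ x ∈ closedNbr G p ∧ ∀ w ∈ closedNbr G p, w ∈ I → w = x := by
  constructor
  · rintro ⟨-, h⟩
    have hx : x ∈ closedNbr G p ∩ I := h ▸ rfl
    exact ⟨hx.2, hx.1, fun w hw hI => h.subset ⟨hw, hI⟩⟩
  · rintro ⟨hI, hx, h⟩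
    refine ⟨?_, Subset.antisymm (fun w hw => h w hw.1 hw.2) ?_⟩
    · rw [mem_closedNbr] at hx ⊢
      exact hx.imp Eq.symm G.adj_symm
    · rintro _ rfl
      exact ⟨hx, hI⟩

theorem privSet_anti {G : SimpleGraph V} {x : V} {I J : Set V} (hJI : J ⊆ I) (hx : x ∈ J) :
    privSet G x I ⊆ privSet G x J := by
  intro p hp
  rw [mem_privSet] at hp ⊢
  exact ⟨hx, hp.2.1, fun w hw hJ => hp.2.2 w hw (hJI hJ)⟩

theorem DomOver.exists_minDomOver_subset [Finite V] {G : SimpleGraph V} {S B : Set V}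
    (h : DomOver G S B) : ∃ T ⊆ S, MinDomOver G T B := by
  obtain ⟨T, hTS, hT⟩ := exists_minimal_le_of_wellFoundedLT (fun T => DomOver G T B) S h
  exact ⟨T, hTS, hT.prop, fun S' hS' hdom => hT.not_prop_of_lt hS' hdom⟩

theorem MinDomOver.exists_private {G : SimpleGraph V} {S B : Set V} (h : MinDomOver G S B)
    {s : V} (hs : s ∈ S) : ∃ b ∈ B, G.Adj s b ∧ ∀ t ∈ S, G.Adj t b → t = s := by
  have hnot := h.2 (S \ {s}) (sdiff_singleton_ssubset.2 hs)
  simp only [DomOver, not_forall, not_exists, not_and] at hnot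
  obtain ⟨b, hb, hnot⟩ := hnot
  have huniq : ∀ t ∈ S, G.Adj t b → t = s := fun t ht htb => by
    by_contra hne
    exact hnot t ⟨ht, hne⟩ htb
  obtain ⟨t, ht, htb⟩ := h.1 b hb
  exact ⟨b, hb, huniq t ht htb ▸ htb, huniq⟩

theorem minRedundant_of_privSet {G : SimpleGraph V} {R : Set V} {x : V}
    (hred : redVerts G R = {x})
    (hx : ∀ r ∈ R, r ≠ x → (privSet G x (R \ {r})).Nonempty) : MinRedundant G R := by
  have hxR : x ∈ redVerts G R := hred ▸ rfl
  refine ⟨fun hirr => (hirr x hxR.1).ne_empty hxR.2, fun S hS hSred => hSred fun v hv => ?_⟩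
  obtain ⟨r, hrR, hrS⟩ := exists_of_ssubset hS
  by_cases hvx : v = x
  · subst hvx
    refine (hx r hrR fun h => hrS (h ▸ hv)).mono (privSet_anti (fun w hw => ?_) hv)
    exact ⟨hS.subset hw, fun h => hrS (mem_singleton_iff.1 h ▸ hw)⟩
  · refine (nonempty_iff_ne_empty.2 fun he => hvx ?_).mono (privSet_anti hS.subset hv)
    exact hred.subset ⟨hS.subset hv, he⟩

theorem MinRedundant.privSet_nonempty {G : SimpleGraph V} {R : Set V} (hR : MinRedundant G R)
    {x r : V} (hx : x ∈ R) (hr : r ∈ R) (hne : x ≠ r) :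
    (privSet G x (R \ {r})).Nonempty :=
  not_not.1 (hR.2 _ (sdiff_singleton_ssubset.2 hr)) x ⟨hx, hne⟩

theorem mem_nbrUnion {G : SimpleGraph V} {Y : Set V} {v : V} :
    v ∈ nbrUnion G Y ↔ ∃ y ∈ Y, G.Adj y v := by
  simp [nbrUnion]

theorem privSet_nonempty_of_extendable {G : SimpleGraph V} {R Y : Set V} {x y : V}
    (hred : redVerts G R = {x}) (hRY : R ∩ G.neighborSet x = Y) (hy : y ∈ Y) :
    (privSet G y (Y ∪ {x})).Nonempty := by
  subst hRY
  have hxR : x ∈ redVerts G R := hred ▸ rfl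
  have hxy : G.Adj x y := hy.2
  refine (nonempty_iff_ne_empty.2 fun he => hxy.ne' (hred.subset ⟨hy.1, he⟩)).mono
    (privSet_anti ?_ (Or.inl hy))
  rintro w (hw | rfl)
  exacts [hw.1, hxR.1]

theorem domOver_of_extendable {G : SimpleGraph V} (h3 : CFree G 3) {R Y : Set V} {x : V}
    (hR : MinRedundant G R) (hred : redVerts G R = {x}) (hRY : R ∩ G.neighborSet x = Y)
    (hY : Y.Nontrivial) :
    DomOver G (sphere2 G x \ nbrUnion G Y) (G.neighborSet x \ Y) := by
  subst hRY
  have hxR : x ∈ redVerts G R := hred ▸ rfl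
  rintro z ⟨hxz : G.Adj x z, hzY⟩
  have hzR : z ∉ R := fun h => hzY ⟨h, hxz⟩
  obtain ⟨s, hs, hsR, hsx⟩ : ∃ s ∈ closedNbr G z, s ∈ R ∧ s ≠ x := by
    by_contra! h
    exact (hxR.2.subset (mem_privSet.2 ⟨hxR.1, Or.inr hxz.symm, h⟩) : z ∈ (∅ : Set V))
  have hzs : G.Adj z s := hs.resolve_left fun h => hzR (h ▸ hsR)
  refine ⟨s, ⟨⟨hsx, fun h => h3.not_triangle hxz hzs h.symm, z, hxz, hzs⟩, fun hsY => ?_⟩,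
    hzs.symm⟩
  obtain ⟨y, hy, hys⟩ := mem_nbrUnion.1 hsY
  have hxy : G.Adj x y := hy.2
  obtain ⟨p, hp⟩ := hR.privSet_nonempty hxR.1 hy.1 hxy.ne
  rw [mem_privSet] at hp
  obtain ⟨-, hpx, hp⟩ := hp
  rcases hpx with rfl | hpx
  · obtain ⟨y', hy', hne⟩ := hY.exists_ne y
    have hxy' : G.Adj x y' := hy'.2
    exact hxy'.ne' (hp y' (Or.inr hxy') ⟨hy'.1, hne⟩)
  · by_cases hpy : p = y
    · subst hpy
      exact hsx (hp s (Or.inr hys) ⟨hsR, hys.ne'⟩)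
    · have hpR : p ∉ R := fun h => hpx.ne (hp p (Or.inl rfl) ⟨h, hpy⟩)
      have hempty : p ∉ privSet G x R := hxR.2 ▸ notMem_empty p
      refine hempty (mem_privSet.2 ⟨hxR.1, Or.inr hpx, fun w hw hwR => ?_⟩)
      refine hp w hw ⟨hwR, ?_⟩
      rintro rfl
      exact h3.not_triangle hpx hxy (hw.resolve_left fun h => hpR (h ▸ hwR)).symm

theorem exists_minRedundant_of_minDomOver {G : SimpleGraph V} (h3 : CFree G 3) (h5 : CFree G 5)
    {x : V} {Y S : Set V} (hY : Y ⊆ G.neighborSet x) (hYne : Y.Nonempty)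
    (hpriv : ∀ y ∈ Y, (privSet G y (Y ∪ {x})).Nonempty)
    (hS : S ⊆ sphere2 G x \ nbrUnion G Y) (hdom : MinDomOver G S (G.neighborSet x \ Y)) :
    ∃ R : Set V, MinRedundant G R ∧ redVerts G R = {x} ∧ R ∩ G.neighborSet x = Y := by
  have hYS : ∀ y ∈ Y, ∀ s ∈ S, ¬ G.Adj y s := fun y hy s hs h =>
    (hS hs).2 (mem_nbrUnion.2 ⟨y, hy, h⟩)
  have hYY : ∀ y ∈ Y, ∀ y' ∈ Y, ¬ G.Adj y y' := fun y hy y' hy' h =>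
    h3.not_triangle (hY hy) h (hY hy' : G.Adj x y').symm
  have hSS : ∀ s ∈ S, ∀ t ∈ S, ¬ G.Adj s t := fun s hs t ht hst => by
    obtain ⟨z, hz, hsz, -⟩ := hdom.exists_private hs
    obtain ⟨z', hz', htz', -⟩ := hdom.exists_private ht
    exact h3.not_pentagon h5 hz.1 hsz.symm hst htz' (G.adj_symm hz'.1)
  set R : Set V := insert x (Y ∪ S)
  have hYR : ∀ {y}, y ∈ Y → y ∈ R := fun h => Or.inr (Or.inl h)
  have hSR : ∀ {s}, s ∈ S → s ∈ R := fun h => Or.inr (Or.inr h)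
  have hxred : privSet G x R = ∅ := by
    refine eq_empty_of_forall_notMem fun p hp => ?_
    obtain ⟨-, rfl | hpx, hp⟩ := mem_privSet.1 hp
    · obtain ⟨y, hy⟩ := hYne
      exact (hY hy : G.Adj x y).ne' (hp y (Or.inr (hY hy)) (hYR hy))
    · by_cases hpY : p ∈ Y
      · exact hpx.ne (hp p (Or.inl rfl) (hYR hpY))
      · obtain ⟨s, hs, hsp⟩ := hdom.1 p ⟨hpx.symm, hpY⟩
        exact (hS hs).1.1 (hp s (Or.inr hsp.symm) (hSR hs))
  have hYpriv : ∀ y ∈ Y, (privSet G y R).Nonempty := fun y hy => by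
    obtain ⟨p, hp⟩ := hpriv y hy
    obtain ⟨-, hpy, hp⟩ := mem_privSet.1 hp
    have hxy : G.Adj x y := hY hy
    replace hpy : G.Adj p y := hpy.resolve_left fun h => by
      subst h
      exact hxy.ne (hp x (Or.inr hxy.symm) (Or.inr rfl))
    refine ⟨p, mem_privSet.2 ⟨hYR hy, Or.inr hpy, ?_⟩⟩
    rintro w hw (rfl | hwY | hwS)
    · exact hp _ hw (Or.inr rfl)
    · exact hp _ hw (Or.inl hwY)
    · obtain rfl | hpw := hw
      · exact (hYS y hy _ hwS hpy.symm).elim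
      · obtain ⟨z, hz, hwz, -⟩ := hdom.exists_private hwS
        exact (h3.not_pentagon h5 hxy hpy.symm hpw hwz (G.adj_symm hz.1)).elim
  have hSpriv : ∀ s ∈ S, (privSet G s R).Nonempty := fun s hs => by
    refine ⟨s, mem_privSet.2 ⟨hSR hs, Or.inl rfl, ?_⟩⟩
    rintro w (rfl | hsw) hwR
    · rfl
    obtain rfl | hwY | hwS := hwR
    · exact ((hS hs).1.2.1 hsw.symm).elim
    · exact (hYS w hwY s hs hsw.symm).elim
    · exact (hSS s hs w hwS hsw).elim
  have hred : redVerts G R = {x} := by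
    refine Subset.antisymm ?_ ?_
    · rintro v ⟨rfl | hv | hv, he⟩
      exacts [rfl, ((hYpriv v hv).ne_empty he).elim, ((hSpriv v hv).ne_empty he).elim]
    · rintro _ rfl
      exact ⟨Or.inl rfl, hxred⟩
  refine ⟨R, minRedundant_of_privSet hred ?_, hred, ?_⟩
  · rintro r (rfl | hr | hr) hrx
    · exact (hrx rfl).elim
    · refine ⟨r, mem_privSet.2 ⟨⟨Or.inl rfl, hrx.symm⟩, Or.inr (G.adj_symm (hY hr)), ?_⟩⟩
      rintro w (rfl | hrw) ⟨hwR, hwr⟩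
      · exact (hwr rfl).elim
      obtain rfl | hwY | hwS := hwR
      exacts [rfl, (hYY r hr w hwY hrw).elim, (hYS r hr w hwS hrw).elim]
    · obtain ⟨z, ⟨hxz, hzY⟩, hrz, hz⟩ := hdom.exists_private hr
      replace hxz : G.Adj x z := hxz
      refine ⟨z, mem_privSet.2 ⟨⟨Or.inl rfl, hrx.symm⟩, Or.inr hxz.symm, ?_⟩⟩
      rintro w hw ⟨rfl | hwY | hwS, hwr⟩
      · rfl
      · obtain rfl | hzw := hw
        exacts [(hzY hwY).elim, (h3.not_triangle hxz hzw (G.adj_symm (hY hwY))).elim]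
      · obtain rfl | hzw := hw
        exacts [((hS hwS).1.2.1 hxz).elim, (hwr (hz w hwS hzw.symm)).elim]
  · refine Subset.antisymm ?_ fun y hy => ⟨hYR hy, hY hy⟩
    rintro v ⟨rfl | hv | hv, hxv⟩
    exacts [(G.loopless.irrefl _ hxv).elim, hv, ((hS hv).1.2.1 hxv).elim]

/-- characterization of extendable sets in `(C₃, C₅, C₆)`-free graphs:
`Y ⊆ N(x)` with `|Y| ≥ 2` is extendable w.r.t. `x` iff every `y ∈ Y` has a private
neighbor w.r.t. `Y ∪ {x}` and `N²(x) \ N(Y)` dominates `N(x) \ Y`. -/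
theorem stmt18 [Fintype V] (G : SimpleGraph V) (h3 : CFree G 3) (h5 : CFree G 5)
    (h6 : CFree G 6) (x : V) (Y : Set V) (hY : Y ⊆ G.neighborSet x)
    (hcard : 2 ≤ Y.ncard) :
    (∃ R : Set V, MinRedundant G R ∧ redVerts G R = {x} ∧ R ∩ G.neighborSet x = Y) ↔
    ((∀ y ∈ Y, (privSet G y (Y ∪ {x})).Nonempty) ∧
      DomOver G (sphere2 G x \ nbrUnion G Y) (G.neighborSet x \ Y)) := by
  have hY2 : Y.Nontrivial := one_lt_ncard_iff_nontrivial.1 hcard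
  constructor
  · rintro ⟨R, hR, hred, hRY⟩
    exact ⟨fun y hy => privSet_nonempty_of_extendable hred hRY hy,
      domOver_of_extendable h3 hR hred hRY hY2⟩
  · rintro ⟨hpriv, hdom⟩
    obtain ⟨S, hS, hmin⟩ := hdom.exists_minDomOver_subset
    exact exists_minRedundant_of_minDomOver h3 h5 hY hY2.nonempty hpriv hS hmin
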